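/- arXiv:1908.06533 — 2 statements merged into one kernel-verified Lean document; each statement's English description precedes it below -/
import Mathlib

section
/- Let A > 0 and let x : ℝ → ℝ be a twice differentiable solution of the single-well Duffing equation x''(t) + x(t) + x(t)³ = 0 with initial conditions x(0) = A and x'(0) = 0. Then x is nonconstant periodic with minimal period p given by p = 4·∫₀^A du / √((A² − u²)·(1 + A²/2 + u²/2)). -/
open intervalIntegral

/-- A nonnegative function with `|f'| ≤ K f` that vanishes somewhere vanishes identically. -/
theorem eq_zero_of_abs_deriv_le_mul {f f' : ℝ → ℝ} {K t₀ : ℝ}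
    (hf : ∀ t, HasDerivAt f (f' t) t) (hbound : ∀ t, |f' t| ≤ K * f t)
    (hnonneg : ∀ t, 0 ≤ f t) (hzero : f t₀ = 0) (t : ℝ) : f t = 0 := by
  have hexp (c s : ℝ) : HasDerivAt (fun t => f t * Real.exp (c * t))
      ((f' s + c * f s) * Real.exp (c * s)) s := by
    have h := (hf s).mul (((hasDerivAt_id s).const_mul c).exp)
    refine h.congr_deriv ?_
    simp only [id]
    ring
  refine le_antisymm ?_ (hnonneg t)
  rcases le_total t₀ t with h | h
  · have hanti : Antitone (fun t => f t * Real.exp (-K * t)) := by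
      refine antitone_of_hasDerivAt_nonpos (hexp (-K)) fun s => ?_
      have := (abs_le.1 (hbound s)).2
      exact mul_nonpos_of_nonpos_of_nonneg (by linarith) (Real.exp_pos _).le
    have := hanti h
    simp only [hzero, zero_mul] at this
    exact nonpos_of_mul_nonpos_left this (Real.exp_pos _)
  · have hmono : Monotone (fun t => f t * Real.exp (K * t)) := by
      refine monotone_of_hasDerivAt_nonneg (hexp K) fun s => ?_
      have := (abs_le.1 (hbound s)).1
      exact mul_nonneg (by linarith) (Real.exp_pos _).le
    have := hmono h
    simp only [hzero, zero_mul] at this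
    exact nonpos_of_mul_nonpos_left this (Real.exp_pos _)

/-- `(x, y)` solves the first-order system of the single-well Duffing equation. -/
structure IsDuffingSolution (x y : ℝ → ℝ) : Prop where
  hasDerivAt_fst : ∀ t, HasDerivAt x (y t) t
  hasDerivAt_snd : ∀ t, HasDerivAt y (-x t - x t ^ 3) t

namespace IsDuffingSolution

variable {x y z w : ℝ → ℝ} {A : ℝ}

theorem energy_eq (h : IsDuffingSolution x y) (h0 : x 0 = A) (h0' : y 0 = 0) (t : ℝ) :
    y t ^ 2 = (A ^ 2 - x t ^ 2) * (1 + A ^ 2 / 2 + x t ^ 2 / 2) := by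
  have hd (s : ℝ) : HasDerivAt (fun s => y s ^ 2 + x s ^ 2 + x s ^ 4 / 2) 0 s := by
    refine ((((h.hasDerivAt_snd s).pow 2).add ((h.hasDerivAt_fst s).pow 2)).add
      (((h.hasDerivAt_fst s).pow 4).div_const 2)).congr_deriv ?_
    push_cast
    ring
  have := is_const_of_deriv_eq_zero (fun s => (hd s).differentiableAt) (fun s => (hd s).deriv) t 0
  simp only [h0, h0'] at this
  linarith

theorem abs_le (h : IsDuffingSolution x y) (hA : 0 < A) (h0 : x 0 = A) (h0' : y 0 = 0) (t : ℝ) :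
    |x t| ≤ A := by
  refine abs_le_of_sq_le_sq ?_ hA.le
  by_contra! hlt
  have := h.energy_eq h0 h0' t
  nlinarith [sq_nonneg (y t), sq_nonneg A, sq_nonneg (x t)]

/-- Bounded solutions with the same state at one time coincide. -/
theorem eq_of_abs_le (h : IsDuffingSolution x y) (h' : IsDuffingSolution z w)
    (hx : ∀ t, |x t| ≤ A) (hz : ∀ t, |z t| ≤ A) {t₀ : ℝ} (hfst : x t₀ = z t₀)
    (hsnd : y t₀ = w t₀) (t : ℝ) : x t = z t := by
  have hd (s : ℝ) : HasDerivAt (fun s => (x s - z s) ^ 2 + (y s - w s) ^ 2)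
      (-(2 * ((x s - z s) * (y s - w s)) * (x s ^ 2 + x s * z s + z s ^ 2))) s := by
    refine ((((h.hasDerivAt_fst s).sub (h'.hasDerivAt_fst s)).pow 2).add
      (((h.hasDerivAt_snd s).sub (h'.hasDerivAt_snd s)).pow 2)).congr_deriv ?_
    simp only [Pi.sub_apply]
    push_cast
    ring
  have hzero := eq_zero_of_abs_deriv_le_mul (K := 3 * A ^ 2) (t₀ := t₀) hd
    (fun s => by
      rw [abs_neg, abs_mul, mul_comm]
      have hx2 : x s ^ 2 ≤ A ^ 2 := sq_le_sq.2 ((hx s).trans (le_abs_self A))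
      have hz2 : z s ^ 2 ≤ A ^ 2 := sq_le_sq.2 ((hz s).trans (le_abs_self A))
      refine mul_le_mul ?_ ?_ (abs_nonneg _) (by positivity)
      · rw [_root_.abs_le]
        constructor <;> nlinarith [sq_nonneg (x s - z s), sq_nonneg (x s + z s)]
      · rw [_root_.abs_le]
        constructor <;> nlinarith [sq_nonneg (x s - z s + (y s - w s)),
          sq_nonneg (x s - z s - (y s - w s))])
    (fun s => by positivity) (by simp [hfst, hsnd]) t
  nlinarith [sq_nonneg (x t - z t), sq_nonneg (y t - w t)]

theorem comp_const_sub (h : IsDuffingSolution x y) (a : ℝ) :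
    IsDuffingSolution (fun t => x (a - t)) (fun t => -y (a - t)) where
  hasDerivAt_fst t := (h.hasDerivAt_fst (a - t)).comp_const_sub a t
  hasDerivAt_snd t := ((h.hasDerivAt_snd (a - t)).comp_const_sub a t).neg.congr_deriv (by ring)

theorem neg (h : IsDuffingSolution x y) :
    IsDuffingSolution (fun t => -x t) (fun t => -y t) where
  hasDerivAt_fst t := (h.hasDerivAt_fst t).neg
  hasDerivAt_snd t := (h.hasDerivAt_snd t).neg.congr_deriv (by ring)

theorem snd_lt_zero (h : IsDuffingSolution x y) (h0' : y 0 = 0) {T : ℝ}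
    (hpos : ∀ t ∈ Set.Ico 0 T, 0 < x t) {t : ℝ} (ht : t ∈ Set.Ioc 0 T) : y t < 0 := by
  have hanti : StrictAntiOn y (Set.Icc 0 T) := by
    refine strictAntiOn_of_hasDerivWithinAt_neg (convex_Icc 0 T)
      (fun s _ => (h.hasDerivAt_snd s).continuousAt.continuousWithinAt)
      (fun s _ => (h.hasDerivAt_snd s).hasDerivWithinAt) fun s hs => ?_
    rw [interior_Icc] at hs
    have := hpos s ⟨hs.1.le, hs.2⟩
    have := pow_pos this 3
    linarith
  rw [← h0']
  exact hanti ⟨le_rfl, ht.1.le.trans ht.2⟩ ⟨ht.1.le, ht.2⟩ ht.1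

theorem strictAntiOn (h : IsDuffingSolution x y) (h0' : y 0 = 0) {T : ℝ}
    (hpos : ∀ t ∈ Set.Ico 0 T, 0 < x t) : StrictAntiOn x (Set.Icc 0 T) := by
  refine strictAntiOn_of_hasDerivWithinAt_neg (convex_Icc 0 T)
    (fun s _ => (h.hasDerivAt_fst s).continuousAt.continuousWithinAt)
    (fun s _ => (h.hasDerivAt_fst s).hasDerivWithinAt) fun s hs => ?_
  rw [interior_Icc] at hs
  exact h.snd_lt_zero h0' hpos ⟨hs.1, hs.2.le⟩

theorem exists_nonpos (h : IsDuffingSolution x y) (h0' : y 0 = 0) : ∃ t, 0 ≤ t ∧ x t ≤ 0 := by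
  by_contra! hpos
  have hy1 : y 1 < 0 := h.snd_lt_zero (T := 1) h0' (fun t ht => hpos t ht.1) (by simp)
  have hyanti : AntitoneOn y (Set.Ici 0) := by
    refine antitoneOn_of_hasDerivWithinAt_nonpos (convex_Ici 0)
      (fun s _ => (h.hasDerivAt_snd s).continuousAt.continuousWithinAt)
      (fun s _ => (h.hasDerivAt_snd s).hasDerivWithinAt) fun s hs => ?_
    have := hpos s (interior_subset hs)
    have := pow_pos this 3
    linarith
  have hxanti : AntitoneOn (fun t => x t - y 1 * t) (Set.Ici 1) := by
    have hd (s : ℝ) : HasDerivAt (fun t => x t - y 1 * t) (y s - y 1) s :=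
      ((h.hasDerivAt_fst s).sub ((hasDerivAt_id s).const_mul (y 1))).congr_deriv (by ring)
    refine antitoneOn_of_hasDerivWithinAt_nonpos (convex_Ici 1)
      (fun s _ => (hd s).continuousAt.continuousWithinAt)
      (fun s _ => (hd s).hasDerivWithinAt) fun s hs => ?_
    have hs1 : (1 : ℝ) ≤ s := interior_subset hs
    have := hyanti (Set.mem_Ici.2 zero_le_one) (Set.mem_Ici.2 (by linarith)) hs1
    linarith
  have hx1 := hpos 1 zero_le_one
  have hq : 0 < x 1 / -y 1 := div_pos hx1 (neg_pos.2 hy1)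
  have hle := hxanti (Set.mem_Ici.2 le_rfl)
    (Set.mem_Ici.2 (by linarith : (1 : ℝ) ≤ 1 + x 1 / -y 1)) (by linarith)
  have hlt := hpos (1 + x 1 / -y 1) (by linarith)
  have : y 1 * (x 1 / -y 1) = -x 1 := by
    field_simp [hy1.ne]
  simp only at hle
  linarith

/-- A solution starting at rest from a positive position has a first positive zero. -/
theorem exists_first_zero (h : IsDuffingSolution x y) (h0 : 0 < x 0) (h0' : y 0 = 0) :
    ∃ T, 0 < T ∧ x T = 0 ∧ ∀ t ∈ Set.Ico 0 T, 0 < x t := by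
  have hcont : Continuous x :=
    continuous_iff_continuousAt.2 fun t => (h.hasDerivAt_fst t).continuousAt
  obtain ⟨b, hb, hxb⟩ := h.exists_nonpos h0'
  let S := Set.Ici (0 : ℝ) ∩ x ⁻¹' Set.Iic 0
  have hS : IsClosed S := isClosed_Ici.inter (isClosed_Iic.preimage hcont)
  have hbdd : BddBelow S := ⟨0, fun t ht => ht.1⟩
  have hmem : sInf S ∈ S := hS.csInf_mem ⟨b, hb, hxb⟩ hbdd
  have hpos : ∀ t ∈ Set.Ico 0 (sInf S), 0 < x t := fun t ht => by
    by_contra! hle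
    exact absurd (csInf_le hbdd (show t ∈ S from ⟨ht.1, hle⟩)) (not_le.2 ht.2)
  have hT : 0 < sInf S := by
    refine lt_of_le_of_ne hmem.1 fun heq => ?_
    have := hmem.2
    rw [← heq] at this
    exact absurd h0 (not_lt.2 this)
  refine ⟨sInf S, hT, le_antisymm hmem.2 ?_, hpos⟩
  have hmem_closure : sInf S ∈ closure (Set.Ico 0 (sInf S)) := by
    rw [closure_Ico hT.ne]
    exact ⟨hT.le, le_rfl⟩
  exact closure_minimal (fun t ht => (hpos t ht).le) (isClosed_Ici.preimage hcont) hmem_closure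

/-- The time to fall from the amplitude to the first zero is the elliptic integral. -/
theorem integral_eq_first_zero (h : IsDuffingSolution x y) (hA : 0 < A) (h0 : x 0 = A)
    (h0' : y 0 = 0) {T : ℝ} (hT : 0 < T) (hxT : x T = 0) (hpos : ∀ t ∈ Set.Ico 0 T, 0 < x t) :
    ∫ u in (0 : ℝ)..A, 1 / Real.sqrt ((A ^ 2 - u ^ 2) * (1 + A ^ 2 / 2 + u ^ 2 / 2)) = T := by
  have hanti := h.strictAntiOn h0' hpos
  have himage : x '' Set.Ioo 0 T = Set.Ioo 0 A := by
    apply Set.Subset.antisymm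
    · rintro _ ⟨t, ht, rfl⟩
      refine ⟨hpos t ⟨ht.1.le, ht.2⟩, ?_⟩
      rw [← h0]
      exact hanti ⟨le_rfl, hT.le⟩ ⟨ht.1.le, ht.2.le⟩ ht.1
    · have := intermediate_value_Ioo' hT.le
        (fun s _ => (h.hasDerivAt_fst s).continuousAt.continuousWithinAt : ContinuousOn x _)
      rwa [h0, hxT] at this
  rw [integral_of_le hA.le, MeasureTheory.integral_Ioc_eq_integral_Ioo, ← himage,
    MeasureTheory.integral_image_eq_integral_abs_deriv_smul measurableSet_Ioo
      (fun s _ => (h.hasDerivAt_fst s).hasDerivWithinAt)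
      (hanti.injOn.mono Set.Ioo_subset_Icc_self)]
  have hone : Set.EqOn (fun t => |y t| • (1 / Real.sqrt ((A ^ 2 - x t ^ 2) *
      (1 + A ^ 2 / 2 + x t ^ 2 / 2)))) (fun _ => (1 : ℝ)) (Set.Ioo 0 T) := fun t ht => by
    have hy := h.snd_lt_zero h0' hpos ⟨ht.1, ht.2.le⟩
    simp only [← h.energy_eq h0 h0' t, Real.sqrt_sq_eq_abs, smul_eq_mul]
    exact mul_one_div_cancel (abs_pos.2 hy.ne).ne'
  rw [MeasureTheory.setIntegral_congr_fun measurableSet_Ioo hone]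
  simp [hT.le]

theorem even (h : IsDuffingSolution x y) (hA : 0 < A) (h0 : x 0 = A) (h0' : y 0 = 0) (t : ℝ) :
    x (-t) = x t := by
  have hbound := h.abs_le hA h0 h0'
  simpa using (h.eq_of_abs_le (h.comp_const_sub 0) hbound (fun s => hbound (0 - s)) (t₀ := 0)
    (by simp) (by simp [h0']) t).symm

theorem add_two_mul_of_zero (h : IsDuffingSolution x y) (hA : 0 < A) (h0 : x 0 = A)
    (h0' : y 0 = 0) {T : ℝ} (hxT : x T = 0) (t : ℝ) : x (t + 2 * T) = -x t := by
  have hbound := h.abs_le hA h0 h0'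
  have hTT : 2 * T - T = T := by ring
  have := h.eq_of_abs_le (h.comp_const_sub (2 * T)).neg hbound
    (fun s => by simpa using hbound (2 * T - s)) (t₀ := T)
    (by simp [hTT, hxT]) (by simp [hTT]) (t + 2 * T)
  rw [this, show 2 * T - (t + 2 * T) = -t by ring, h.even hA h0 h0']

/-- Four times the first zero is the minimal period. -/
theorem isLeast_period (h : IsDuffingSolution x y) (hA : 0 < A) (h0 : x 0 = A)
    (h0' : y 0 = 0) {T : ℝ} (hT : 0 < T) (hxT : x T = 0) (hpos : ∀ t ∈ Set.Ico 0 T, 0 < x t) :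
    IsLeast {q : ℝ | 0 < q ∧ ∀ t : ℝ, x (t + q) = x t} (4 * T) := by
  have hhalf := h.add_two_mul_of_zero hA h0 h0' hxT
  have hper (t : ℝ) : x (t + 4 * T) = x t := by
    rw [show t + 4 * T = t + 2 * T + 2 * T by ring, hhalf, hhalf, neg_neg]
  have heven := h.even hA h0 h0'
  have hlt {t : ℝ} (ht : t ∈ Set.Ioc 0 T) : x t < A := by
    rw [← h0]
    exact h.strictAntiOn h0' hpos ⟨le_rfl, hT.le⟩ ⟨ht.1.le, ht.2⟩ ht.1
  have hnonneg {t : ℝ} (ht : |t| ≤ T) : 0 ≤ x t := by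
    have habs : x |t| = x t := by
      rcases abs_choice t with h' | h' <;> rw [h']
      exact heven t
    rw [← habs]
    rcases ht.lt_or_eq with h' | h'
    · exact (hpos _ ⟨abs_nonneg t, h'⟩).le
    · rw [h', hxT]
  refine ⟨⟨by linarith, hper⟩, fun q ⟨hq, hqper⟩ => ?_⟩
  by_contra! hq4
  have hxq : x q = A := by simpa [h0] using hqper 0
  rcases le_or_gt q T with h1 | h1
  · exact (hlt ⟨hq, h1⟩).ne hxq
  rcases le_or_gt q (3 * T) with h3 | h3
  · have := hhalf (q - 2 * T)
    rw [sub_add_cancel, hxq] at this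
    have := hnonneg (t := q - 2 * T) (_root_.abs_le.2 ⟨by linarith, by linarith⟩)
    linarith
  · refine (hlt (t := 4 * T - q) ⟨by linarith, by linarith⟩).ne ?_
    rw [← hxq, ← heven q, ← hper (-q), neg_add_eq_sub]

end IsDuffingSolution

/-- the minimal period of the single-well Duffing solution with
amplitude `A > 0` is given by the elliptic integral. -/
theorem singleWell_period_integral
    (A : ℝ) (hA : 0 < A)
    (x : ℝ → ℝ) (hx : Differentiable ℝ x) (hx' : Differentiable ℝ (deriv x))
    (hode : ∀ t : ℝ, deriv (deriv x) t + x t + (x t) ^ 3 = 0)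
    (h0 : x 0 = A) (h0' : deriv x 0 = 0) :
    IsLeast {q : ℝ | 0 < q ∧ ∀ t : ℝ, x (t + q) = x t}
      (4 * ∫ u in (0:ℝ)..A, 1 / Real.sqrt ((A ^ 2 - u ^ 2) * (1 + A ^ 2 / 2 + u ^ 2 / 2))) := by
  have h : IsDuffingSolution x (deriv x) :=
    ⟨fun t => (hx t).hasDerivAt,
      fun t => (hx' t).hasDerivAt.congr_deriv (by linarith [hode t])⟩
  obtain ⟨T, hT, hxT, hpos⟩ := h.exists_first_zero (h0 ▸ hA) h0'
  rw [h.integral_eq_first_zero hA h0 h0' hT hxT hpos]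
  exact h.isLeast_period hA h0 h0' hT hxT hpos
end

section
/- Let x, y : ℝ → ℝ be twice differentiable solutions of the double-well Duffing equation x''(t) − x(t) + x(t)³ = 0, both with strictly positive energy H = (1/2)·x'(t)² − (1/2)·x(t)² + (1/4)·x(t)⁴ > 0, and suppose x and y have the same minimal period p > 0. Then there exists θ ∈ ℝ such that y(t) = x(t + θ) for all t ∈ ℝ. -/
open Set Filter Topology Real in
/-- A strictly positive continuous periodic field on the line has a flow line `φ` which is an order
isomorphism, and the time it takes `φ` to advance by one period `T` of the field is `∫ 1 / g`. -/
theorem exists_orderIso_hasDerivAt_of_periodic {g : ℝ → ℝ} {T : ℝ} (hT : 0 < T)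
    (hg : Continuous g) (hpos : ∀ s, 0 < g s) (hper : Function.Periodic g T) :
    ∃ φ : ℝ ≃o ℝ, (∀ t, HasDerivAt φ (g (φ t)) t) ∧
      ∀ t, φ (t + ∫ s in 0..T, (g s)⁻¹) = φ t + T := by
  have hc : Continuous fun s => (g s)⁻¹ := hg.inv₀ fun s => (hpos s).ne'
  have hpos' : ∀ s, 0 < (g s)⁻¹ := fun s => inv_pos.2 (hpos s)
  have hper' : Function.Periodic (fun s => (g s)⁻¹) T := fun s => by simp only [hper s]
  have hint : ∀ a b, IntervalIntegrable (fun s => (g s)⁻¹) MeasureTheory.volume a b :=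
    fun a b => hc.intervalIntegrable a b
  set τ : ℝ → ℝ := fun u => ∫ s in 0..u, (g s)⁻¹ with hτ
  have hτd : ∀ u, HasDerivAt τ (g u)⁻¹ u := fun u => hc.integral_hasStrictDerivAt 0 u |>.hasDerivAt
  have hmono : StrictMono τ := strictMono_of_hasDerivAt_pos hτd hpos'
  have hcont : Continuous τ := continuous_iff_continuousAt.2 fun u => (hτd u).continuousAt
  have hsurj : Function.Surjective τ := hcont.surjective
    (hper'.tendsto_atTop_intervalIntegral_of_pos' (hint _ _) hpos' hT)
    (hper'.tendsto_atBot_intervalIntegral_of_pos' (hint _ _) hpos' hT)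
  set e := hmono.orderIsoOfSurjective τ hsurj
  have he : ∀ t, τ (e.symm t) = t := fun t => e.apply_symm_apply t
  refine ⟨e.symm, fun t => ?_, fun t => ?_⟩
  · simpa using HasDerivAt.of_local_left_inverse e.symm.continuous.continuousAt
      (hτd (e.symm t)) (hpos' _).ne' (Eventually.of_forall he)
  · apply hmono.injective
    rw [he]
    have h := hper'.intervalIntegral_add_eq_add 0 (e.symm t) hint
    rw [zero_add] at h
    exact (h.trans (congrArg (· + τ T) (he t))).symm

/-- Bounded solutions of `u'' = u - u ^ 3` are determined by their initial data. -/
theorem doubleWell_unique {u u' w w' : ℝ → ℝ} {M : ℝ}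
    (hu : ∀ t, HasDerivAt u (u' t) t) (hu' : ∀ t, HasDerivAt u' (u t - u t ^ 3) t)
    (hw : ∀ t, HasDerivAt w (w' t) t) (hw' : ∀ t, HasDerivAt w' (w t - w t ^ 3) t)
    (hMu : ∀ t, |u t| ≤ M) (hMw : ∀ t, |w t| ≤ M) (h : u 0 = w 0) (h' : u' 0 = w' 0) :
    u = w := by
  have hM : 0 ≤ M := (abs_nonneg _).trans (hMu 0)
  have hlip : LipschitzOnWith (1 + 3 * M ^ 2).toNNReal (fun z : ℝ × ℝ => (z.2, z.1 - z.1 ^ 3))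
      {z | |z.1| ≤ M} := by
    refine LipschitzOnWith.of_dist_le_mul ?_
    rintro ⟨a, b⟩ ha ⟨c, d⟩ hc
    simp only [Set.mem_ofPred_eq] at ha hc
    rw [Real.coe_toNNReal _ (by positivity), Prod.dist_eq, Prod.dist_eq]
    simp only [Real.dist_eq]
    have hK : 1 ≤ 1 + 3 * M ^ 2 := by nlinarith
    have hsq : |1 - (a ^ 2 + a * c + c ^ 2)| ≤ 1 + 3 * M ^ 2 := by
      have ha2 := sq_le_sq' (abs_le.1 ha).1 (abs_le.1 ha).2
      have hc2 := sq_le_sq' (abs_le.1 hc).1 (abs_le.1 hc).2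
      rw [abs_le]
      constructor <;> nlinarith [sq_nonneg (a - c), sq_nonneg (a + c)]
    refine max_le ?_ ?_
    · exact (le_max_right |a - c| |b - d|).trans
        (le_mul_of_one_le_left ((abs_nonneg _).trans (le_max_left _ _)) hK)
    · calc |a - a ^ 3 - (c - c ^ 3)| = |1 - (a ^ 2 + a * c + c ^ 2)| * |a - c| := by
            rw [← abs_mul]; ring_nf
        _ ≤ _ := mul_le_mul hsq (le_max_left _ _) (abs_nonneg _) (by positivity)
  have key := ODE_solution_unique_univ (t₀ := 0) (f := fun t => (u t, u' t))
    (g := fun t => (w t, w' t)) (v := fun _ z => (z.2, z.1 - z.1 ^ 3)) (s := fun _ => {z | |z.1| ≤ M})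
    (fun _ => hlip) (fun t => ⟨(hu t).prodMk (hu' t), hMu t⟩)
    (fun t => ⟨(hw t).prodMk (hw' t), hMw t⟩) (Prod.ext h h')
  exact funext fun t => congrArg Prod.fst (congrFun key t)

/-- The speed of the phase `φ` in the representation `x = √a * sin φ` of a solution of the
double-well Duffing equation with amplitude `√a`. -/
noncomputable def phaseSpeed (a s : ℝ) : ℝ := √((a * Real.sin s ^ 2 + a - 2) / 2)

theorem phaseSpeed_radicand_pos {a : ℝ} (ha : 2 < a) (s : ℝ) :
    0 < (a * Real.sin s ^ 2 + a - 2) / 2 := by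
  have : 0 ≤ a * Real.sin s ^ 2 := mul_nonneg (by linarith) (sq_nonneg _)
  linarith

theorem phaseSpeed_pos {a : ℝ} (ha : 2 < a) (s : ℝ) : 0 < phaseSpeed a s :=
  Real.sqrt_pos.2 (phaseSpeed_radicand_pos ha s)

theorem phaseSpeed_sq {a : ℝ} (ha : 2 < a) (s : ℝ) :
    phaseSpeed a s ^ 2 = (a * Real.sin s ^ 2 + a - 2) / 2 :=
  Real.sq_sqrt (phaseSpeed_radicand_pos ha s).le

theorem continuous_phaseSpeed (a : ℝ) : Continuous (phaseSpeed a) := by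
  unfold phaseSpeed
  fun_prop

theorem phaseSpeed_periodic (a : ℝ) : Function.Periodic (phaseSpeed a) (2 * Real.pi) := fun s => by
  simp only [phaseSpeed, Real.sin_add_two_pi]

theorem hasDerivAt_phaseSpeed {a : ℝ} (ha : 2 < a) (s : ℝ) :
    HasDerivAt (phaseSpeed a) (a * Real.sin s * Real.cos s / (2 * phaseSpeed a s)) s := by
  have h := (((((Real.hasDerivAt_sin s).pow 2).const_mul a).add_const (a - 2)).div_const 2).sqrt
    (by have := phaseSpeed_radicand_pos ha s; simp only [Pi.pow_apply]; linarith)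
  convert h using 1
  · funext s
    simp only [phaseSpeed, Pi.pow_apply, add_sub_assoc]
  · simp only [phaseSpeed, Pi.pow_apply, add_sub_assoc]
    congr 1
    norm_num
    ring

theorem strictAntiOn_integral_inv_phaseSpeed :
    StrictAntiOn (fun a => ∫ s in 0..2 * Real.pi, (phaseSpeed a s)⁻¹) (Set.Ioi 2) := by
  intro a ha b hb hab
  have hlt : ∀ s, (phaseSpeed b s)⁻¹ < (phaseSpeed a s)⁻¹ := fun s => by
    refine inv_strictAnti₀ (phaseSpeed_pos ha s)
      (Real.sqrt_lt_sqrt (phaseSpeed_radicand_pos ha s).le ?_)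
    nlinarith [sq_nonneg (Real.sin s)]
  have hc : ∀ c ∈ Set.Ioi (2 : ℝ), Continuous fun s => (phaseSpeed c s)⁻¹ := fun c hc =>
    (continuous_phaseSpeed c).inv₀ fun s => (phaseSpeed_pos hc s).ne'
  exact intervalIntegral.integral_lt_integral_of_continuousOn_of_le_of_exists_lt Real.two_pi_pos
    (hc b hb).continuousOn (hc a ha).continuousOn (fun s _ => (hlt s).le)
    ⟨0, ⟨le_rfl, Real.two_pi_pos.le⟩, hlt 0⟩

/-- Along a flow line of `phaseSpeed a`, `√a * sin φ` solves the double-well Duffing equation. -/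
theorem hasDerivAt_deriv_sqrt_mul_sin {a : ℝ} (ha : 2 < a) {φ : ℝ → ℝ}
    (hφ : ∀ t, HasDerivAt φ (phaseSpeed a (φ t)) t) (t : ℝ) :
    HasDerivAt (fun t => √a * (Real.cos (φ t) * phaseSpeed a (φ t)))
      (√a * Real.sin (φ t) - (√a * Real.sin (φ t)) ^ 3) t := by
  have h := ((hφ t).cos.mul ((hasDerivAt_phaseSpeed ha (φ t)).comp t (hφ t))).const_mul √a
  refine h.congr_deriv ?_
  rw [Function.comp_apply]
  have hsq := phaseSpeed_sq ha (φ t)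
  have hne := (phaseSpeed_pos ha (φ t)).ne'
  have hcs := Real.sin_sq_add_cos_sq (φ t)
  have ha2 : √a ^ 2 = a := Real.sq_sqrt (by linarith)
  generalize phaseSpeed a (φ t) = g at *
  generalize Real.sin (φ t) = s at *
  generalize Real.cos (φ t) = c at *
  generalize √a = r at *
  have hg : a * s * c / (2 * g) * g = a * s * c / 2 := by field_simp
  rw [hg]
  linear_combination r * s ^ 3 * ha2 - r * s * hsq + r * a * s / 2 * hcs

/-- The initial data of a solution of energy `a ^ 2 / 4 - a / 2` come from some phase. -/
theorem exists_phase {a : ℝ} (ha : 2 < a) {v v' : ℝ}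
    (hE : (1 / 2) * v' ^ 2 - (1 / 2) * v ^ 2 + (1 / 4) * v ^ 4 = a ^ 2 / 4 - a / 2) :
    ∃ s, √a * Real.sin s = v ∧ √a * (Real.cos s * phaseSpeed a s) = v' := by
  have hr : 0 < √a := Real.sqrt_pos.2 (by linarith)
  have ha2 : √a ^ 2 = a := Real.sq_sqrt (by linarith)
  have hv : v ^ 2 ≤ a := by nlinarith [sq_nonneg v', sq_nonneg v]
  have hb := abs_le.1 (Real.abs_le_sqrt hv)
  have hs : Real.sin (Real.arcsin (v / √a)) = v / √a :=
    Real.sin_arcsin (by rw [le_div_iff₀ hr]; linarith [hb.1]) (by rw [div_le_one hr]; exact hb.2)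
  have hprod : (√a * (Real.cos (Real.arcsin (v / √a)) * phaseSpeed a (Real.arcsin (v / √a)))) ^ 2
      = v' ^ 2 := by
    rw [mul_pow, mul_pow, Real.cos_sq', phaseSpeed_sq ha, hs, div_pow, ha2]
    field_simp
    linear_combination -4 * hE
  rcases sq_eq_sq_iff_eq_or_eq_neg.1 hprod with h | h
  · exact ⟨_, by rw [hs]; field_simp, h⟩
  · refine ⟨Real.pi - Real.arcsin (v / √a), by rw [Real.sin_pi_sub, hs]; field_simp, ?_⟩
    rw [phaseSpeed] at h ⊢
    rw [Real.cos_pi_sub, Real.sin_pi_sub]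
    linarith

/-- Every solution of energy `a ^ 2 / 4 - a / 2` is a time shift of `√a * sin φ`. -/
theorem exists_eq_sqrt_mul_sin_shift {a : ℝ} (ha : 2 < a) {φ : ℝ ≃o ℝ}
    (hφ : ∀ t, HasDerivAt φ (phaseSpeed a (φ t)) t) {x : ℝ → ℝ}
    (hx : Differentiable ℝ x) (hx' : Differentiable ℝ (deriv x))
    (hode : ∀ t, deriv (deriv x) t - x t + x t ^ 3 = 0)
    (hE : ∀ t, (1 / 2) * (deriv x t) ^ 2 - (1 / 2) * (x t) ^ 2 + (1 / 4) * (x t) ^ 4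
      = a ^ 2 / 4 - a / 2) :
    ∃ θ, ∀ t, x t = √a * Real.sin (φ (t + θ)) := by
  obtain ⟨s, hs, hs'⟩ := exists_phase ha (hE 0)
  obtain ⟨θ, rfl⟩ := φ.surjective s
  have hψ : ∀ t, HasDerivAt (fun t => φ (t + θ)) (phaseSpeed a (φ (t + θ))) t := fun t =>
    (hφ (t + θ)).comp_add_const t θ
  refine ⟨θ, congrFun (doubleWell_unique (M := √a) (fun t => (hx t).hasDerivAt) (fun t => ?_)
    (fun t => (hψ t).sin.const_mul √a) (hasDerivAt_deriv_sqrt_mul_sin ha hψ) (fun t => ?_)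
    (fun t => ?_) ?_ ?_)⟩
  · have h : x t - x t ^ 3 = deriv (deriv x) t := by linarith [hode t]
    rw [h]
    exact (hx' t).hasDerivAt
  · exact Real.abs_le_sqrt (by nlinarith [sq_nonneg (deriv x t), sq_nonneg (x t), hE t])
  · rw [abs_mul, abs_of_nonneg (Real.sqrt_nonneg a)]
    exact mul_le_of_le_one_right (Real.sqrt_nonneg a) (Real.abs_sin_le_one _)
  · simpa using hs.symm
  · simpa using hs'.symm

/-- The minimal period of `√a * sin φ` and of its time shifts. -/
theorem eq_of_isLeast_period {a : ℝ} (ha : 2 < a) {φ : ℝ ≃o ℝ} {P : ℝ}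
    (hφ : ∀ t, HasDerivAt φ (phaseSpeed a (φ t)) t) (hφP : ∀ t, φ (t + P) = φ t + 2 * Real.pi)
    {x : ℝ → ℝ} {θ : ℝ} (hx : ∀ t, x t = √a * Real.sin (φ (t + θ))) {p : ℝ}
    (hp : IsLeast {q : ℝ | 0 < q ∧ ∀ t, x (t + q) = x t} p) : p = P := by
  have hr : 0 < √a := Real.sqrt_pos.2 (by linarith)
  have hP : 0 < P := by
    have h : φ 0 < φ (0 + P) := by rw [hφP]; linarith [Real.two_pi_pos]
    simpa using φ.lt_iff_lt.1 h
  refine le_antisymm (hp.2 ⟨hP, fun t => ?_⟩) ?_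
  · rw [hx, hx, add_right_comm, hφP, Real.sin_add_two_pi]
  · obtain ⟨hp0, hpx⟩ := hp.1
    have hsin : ∀ t, Real.sin (φ (t + p)) = Real.sin (φ t) := fun t => by
      have h := hpx (t - θ)
      rw [hx, hx, mul_right_inj' hr.ne'] at h
      rw [show t - θ + p + θ = t + p by ring, sub_add_cancel] at h
      exact h
    have hcos : Real.cos (φ (0 + p)) = Real.cos (φ 0) := by
      have h := ((hφ (0 + p)).sin.comp_add_const 0 p).unique
        ((hφ 0).sin.congr_of_eventuallyEq (Filter.Eventually.of_forall hsin))
      have hspeed : phaseSpeed a (φ (0 + p)) = phaseSpeed a (φ 0) := by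
        rw [phaseSpeed, phaseSpeed, hsin]
      rw [hspeed] at h
      exact mul_right_cancel₀ (phaseSpeed_pos ha _).ne' h
    obtain ⟨k, hk⟩ := Real.Angle.angle_eq_iff_two_pi_dvd_sub.1
      (Real.Angle.cos_sin_inj hcos (hsin 0))
    have hlt : φ 0 < φ (0 + p) := φ.lt_iff_lt.2 (by linarith)
    have hk0 : 0 < k := by
      have : 0 < 2 * Real.pi * (k : ℝ) := by linarith
      exact_mod_cast (pos_iff_pos_of_mul_pos this).1 Real.two_pi_pos
    have hk1 : (1 : ℝ) ≤ k := by exact_mod_cast hk0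
    have hle : φ (0 + P) ≤ φ (0 + p) := by
      rw [hφP]
      nlinarith [Real.two_pi_pos]
    simpa using φ.le_iff_le.1 hle

theorem exists_sq_amplitude {E : ℝ} (hE : 0 < E) : ∃ a, 2 < a ∧ E = a ^ 2 / 4 - a / 2 := by
  have h : 1 < √(1 + 4 * E) := Real.lt_sqrt_of_sq_lt (by linarith)
  have hsq : √(1 + 4 * E) ^ 2 = 1 + 4 * E := Real.sq_sqrt (by linarith)
  exact ⟨1 + √(1 + 4 * E), by linarith, by linarith⟩


/-- two positive-energy solutions of the double-well Duffing equation
with the same minimal period agree up to a time shift. -/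
theorem doubleWell_same_period_time_shift
    (x y : ℝ → ℝ)
    (hx : Differentiable ℝ x) (hx' : Differentiable ℝ (deriv x))
    (hy : Differentiable ℝ y) (hy' : Differentiable ℝ (deriv y))
    (hodex : ∀ t : ℝ, deriv (deriv x) t - x t + (x t) ^ 3 = 0)
    (hodey : ∀ t : ℝ, deriv (deriv y) t - y t + (y t) ^ 3 = 0)
    (Ex : ℝ)
    (hEx : ∀ t : ℝ, (1/2) * (deriv x t) ^ 2 - (1/2) * (x t) ^ 2 + (1/4) * (x t) ^ 4 = Ex)
    (hExpos : 0 < Ex)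
    (Ey : ℝ)
    (hEy : ∀ t : ℝ, (1/2) * (deriv y t) ^ 2 - (1/2) * (y t) ^ 2 + (1/4) * (y t) ^ 4 = Ey)
    (hEypos : 0 < Ey)
    (p : ℝ)
    (hpx : IsLeast {q : ℝ | 0 < q ∧ ∀ t : ℝ, x (t + q) = x t} p)
    (hpy : IsLeast {q : ℝ | 0 < q ∧ ∀ t : ℝ, y (t + q) = y t} p) :
    ∃ θ : ℝ, ∀ t : ℝ, y t = x (t + θ) := by
  have hflow : ∀ a : ℝ, 2 < a → _ := fun a ha => exists_orderIso_hasDerivAt_of_periodic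
    Real.two_pi_pos (continuous_phaseSpeed a) (phaseSpeed_pos ha) (phaseSpeed_periodic a)
  obtain ⟨a, ha, rfl⟩ := exists_sq_amplitude hExpos
  obtain ⟨b, hb, rfl⟩ := exists_sq_amplitude hEypos
  obtain ⟨φ, hφ, hφP⟩ := hflow a ha
  obtain ⟨ψ, hψ, hψP⟩ := hflow b hb
  obtain ⟨α, hα⟩ := exists_eq_sqrt_mul_sin_shift ha hφ hx hx' hodex hEx
  obtain ⟨β, hβ⟩ := exists_eq_sqrt_mul_sin_shift hb hψ hy hy' hodey hEy
  obtain rfl : a = b := strictAntiOn_integral_inv_phaseSpeed.injOn ha hb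
    ((eq_of_isLeast_period ha hφ hφP hα hpx).symm.trans (eq_of_isLeast_period hb hψ hψP hβ hpy))
  obtain ⟨γ, hγ⟩ := exists_eq_sqrt_mul_sin_shift ha hφ hy hy' hodey hEy
  refine ⟨γ - α, fun t => ?_⟩
  rw [hγ, hα, add_assoc, sub_add_cancel]
end
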